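/- arXiv:1705.09612 — 2 statements merged into one kernel-verified Lean document; each statement's English description precedes it below -/
import Mathlib

section
/- Let N ≥ 1, let u, v : ℝ^N → [0,∞) be nonnegative Borel measurable functions vanishing at infinity, and let Φ : [0,∞) → [0,∞) be non-decreasing, lower semicontinuous, continuous at 0 and with Φ(0) = 0; extend Φ to [0,∞] by setting Φ(∞) := sup_{s ≥ 0} Φ(s). Then Φ∘u and Φ∘v vanish at infinity and for every x ∈ ℝ^N one has {Φ∘u, Φ∘v}⋆(x) = Φ({u,v}⋆(x)). -/
open MeasureTheory ENNReal

noncomputable section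

/-- Euclidean space `ℝ^N`. -/
abbrev EucN (N : ℕ) : Type := EuclideanSpace ℝ (Fin N)

/-- A function vanishes at infinity if all its strict superlevel sets (of positive level)
have finite Lebesgue measure. -/
def VanishesAtInfinity {N : ℕ} (w : EucN N → ℝ) : Prop :=
  ∀ t : ℝ, 0 < t → volume {x : EucN N | t < |w x|} < ⊤

/-- `A⋆(u,v;t)`: the open ball centered at the origin whose Lebesgue measure equals
`|{|u| > t}| + |{|v| > t}|` (empty if that sum is `0`). -/
def Astar {N : ℕ} (u v : EucN N → ℝ) (t : ℝ) : Set (EucN N) :=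
  {x : EucN N | volume (Metric.ball (0 : EucN N) ‖x‖) <
    volume {y : EucN N | t < |u y|} + volume {y : EucN N | t < |v y|}}

/-- The Shibata rearrangement `{u,v}⋆(x) = ∫₀^∞ χ_{A⋆(u,v;t)}(x) dt`. -/
def shibata {N : ℕ} (u v : EucN N → ℝ) (x : EucN N) : ℝ≥0∞ :=
  ∫⁻ t in Set.Ioi (0 : ℝ), Set.indicator (Astar u v t) (fun _ => (1 : ℝ≥0∞)) x

/-- The extension of `Φ : [0,∞) → [0,∞)` to `[0,∞]`, sending `∞` to `sup_{s ≥ 0} Φ(s)`. -/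
def extendPhi (Φ : ℝ → ℝ) : ℝ≥0∞ → ℝ≥0∞ := fun a =>
  if a = ⊤ then ⨆ s : {s : ℝ // 0 ≤ s}, ENNReal.ofReal (Φ s) else ENNReal.ofReal (Φ a.toReal)

lemma exists_gt_mem_Astar {N : ℕ} {u v : EucN N → ℝ} {x : EucN N} {t : ℝ}
    (h : x ∈ Astar u v t) : ∃ t' > t, x ∈ Astar u v t' := by
  obtain ⟨τ, hanti, hτ, hlim⟩ := exists_seq_strictAnti_tendsto t
  have key (w : EucN N → ℝ) : Filter.Tendsto (fun n => volume {y | τ n < |w y|}) Filter.atTop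
      (nhds (volume {y | t < |w y|})) := by
    have hU : {y | t < |w y|} = ⋃ n, {y | τ n < |w y|} := by
      ext y
      simp only [Set.mem_ofPred_eq, Set.mem_iUnion]
      exact ⟨fun hy => (hlim.eventually_lt_const hy).exists,
        fun ⟨n, hn⟩ => (hτ n).trans hn⟩
    rw [hU]
    refine tendsto_measure_iUnion_atTop fun m n hmn y hy => ?_
    exact (hanti.antitone hmn).trans_lt hy
  obtain ⟨n, hn⟩ := (((key u).add (key v)).eventually_const_lt h).exists
  exact ⟨τ n, hτ n, hn⟩

lemma Astar_antitone {N : ℕ} (u v : EucN N → ℝ) : Antitone (Astar u v) := by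
  intro s t hst x hx
  refine lt_of_lt_of_le hx (add_le_add (measure_mono ?_) (measure_mono ?_)) <;>
    exact fun y hy => hst.trans_lt hy

lemma shibata_eq_volume {N : ℕ} (u v : EucN N → ℝ) (x : EucN N) :
    shibata u v x = volume {t : ℝ | 0 < t ∧ x ∈ Astar u v t} := by
  have hlower : IsLowerSet {t : ℝ | x ∈ Astar u v t} :=
    fun _ _ hst ht => Astar_antitone u v hst ht
  have hmeas : MeasurableSet {t : ℝ | x ∈ Astar u v t} := hlower.ordConnected.measurableSet
  have hind : ∀ t, Set.indicator (Astar u v t) (fun _ => (1 : ℝ≥0∞)) x =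
      Set.indicator {t : ℝ | x ∈ Astar u v t} 1 t := fun _ => rfl
  unfold shibata
  simp_rw [hind]
  rw [lintegral_indicator_one hmeas, Measure.restrict_apply hmeas, Set.inter_comm]
  rfl

lemma ofReal_lt_shibata_iff {N : ℕ} {u v : EucN N → ℝ} {x : EucN N} {t : ℝ} (ht : 0 < t) :
    ENNReal.ofReal t < shibata u v x ↔ x ∈ Astar u v t := by
  rw [shibata_eq_volume]
  refine ⟨fun h => ?_, fun h => ?_⟩
  · by_contra hx
    refine h.not_ge ?_
    calc volume {t : ℝ | 0 < t ∧ x ∈ Astar u v t} ≤ volume (Set.Ioo 0 t) :=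
          measure_mono fun s hs => ⟨hs.1, lt_of_not_ge fun hts => hx (Astar_antitone u v hts hs.2)⟩
      _ = ENNReal.ofReal t := by simp
  · obtain ⟨t', htt', hx⟩ := exists_gt_mem_Astar h
    calc ENNReal.ofReal t < ENNReal.ofReal t' :=
          (ENNReal.ofReal_lt_ofReal_iff (ht.trans htt')).2 htt'
      _ = volume (Set.Ioc 0 t') := by simp
      _ ≤ volume {t : ℝ | 0 < t ∧ x ∈ Astar u v t} :=
          measure_mono fun s hs => ⟨hs.1, Astar_antitone u v hs.2 hx⟩

lemma eq_of_forall_ofReal_lt_iff {a b : ℝ≥0∞}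
    (h : ∀ t : ℝ, 0 < t → (ENNReal.ofReal t < a ↔ ENNReal.ofReal t < b)) : a = b := by
  have aux {a b : ℝ≥0∞} (h : ∀ t : ℝ, 0 < t → ENNReal.ofReal t < a → ENNReal.ofReal t < b) :
      a ≤ b := by
    refine le_of_forall_lt_imp_le_of_dense fun c hc => ?_
    rcases eq_or_ne c 0 with rfl | hc0
    · exact zero_le
    · have hct : c ≠ ⊤ := hc.ne_top
      have := h c.toReal (ENNReal.toReal_pos hc0 hct)
      rw [ENNReal.ofReal_toReal hct] at this
      exact (this hc).le
  exact le_antisymm (aux fun t ht => (h t ht).1) (aux fun t ht => (h t ht).2)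

/-- A positive strict superlevel set of a monotone lower semicontinuous function on `[0,∞)` that
is continuous and vanishing at `0` is empty or an open half-line with positive endpoint. -/
lemma superlevel_empty_or_Ioi {Φ : ℝ → ℝ} (hmono : MonotoneOn Φ (Set.Ici 0))
    (hlsc : LowerSemicontinuousOn Φ (Set.Ici 0))
    (hcont : ContinuousWithinAt Φ (Set.Ici 0) 0) (h0 : Φ 0 = 0) {t : ℝ} (ht : 0 < t) :
    (∀ s, 0 ≤ s → Φ s ≤ t) ∨ ∃ b > 0, ∀ s, 0 ≤ s → (t < Φ s ↔ b < s) := by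
  by_cases hne : ∃ s, 0 ≤ s ∧ t < Φ s
  swap
  · push Not at hne
    exact Or.inl hne
  right
  set S := {s | 0 ≤ s ∧ t < Φ s}
  have hbdd : BddBelow S := ⟨0, fun s hs => hs.1⟩
  have hev : ∀ᶠ s in nhdsWithin (0 : ℝ) (Set.Ici 0), Φ s < t :=
    hcont.eventually_lt_const (by rwa [h0])
  obtain ⟨δ, hδ, hsub⟩ := Metric.mem_nhdsWithin_iff.1 hev
  have hb : 0 < sInf S := by
    refine hδ.trans_le (le_csInf hne fun s hs => le_of_not_gt fun hsδ => ?_)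
    have hball : s ∈ Metric.ball 0 δ := by
      rwa [Metric.mem_ball, Real.dist_0_eq_abs, abs_of_nonneg hs.1]
    have hst : Φ s < t := hsub (Set.mem_inter hball hs.1)
    exact hst.not_gt hs.2
  refine ⟨sInf S, hb, fun s hs => ⟨fun h => ?_, fun h => ?_⟩⟩
  · refine lt_of_le_of_ne (csInf_le hbdd ⟨hs, h⟩) fun heq => ?_
    obtain ⟨ε, hε, hsub⟩ := Metric.mem_nhdsWithin_iff.1 (hlsc s hs t h)
    have hs0 : 0 < s := heq ▸ hb
    have hm : 0 < min ε s := lt_min hε hs0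
    have hle : 0 ≤ s - min ε s / 2 := by linarith [min_le_right ε s]
    have hmem : t < Φ (s - min ε s / 2) := hsub ⟨by
      rw [Metric.mem_ball, Real.dist_eq, sub_sub_cancel_left, abs_neg, abs_of_pos (by positivity)]
      linarith [min_le_left ε s], hle⟩
    have := csInf_le hbdd (show s - min ε s / 2 ∈ S from ⟨hle, hmem⟩)
    linarith
  · obtain ⟨r, hr, hrs⟩ := exists_lt_of_csInf_lt hne h
    exact hr.2.trans_le (hmono hr.1 hs hrs.le)

lemma ofReal_lt_extendPhi_iff {Φ : ℝ → ℝ} {t b : ℝ} (ht : 0 < t) (hb : 0 ≤ b)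
    (h : ∀ s, 0 ≤ s → (t < Φ s ↔ b < s)) (a : ℝ≥0∞) :
    ENNReal.ofReal t < extendPhi Φ a ↔ ENNReal.ofReal b < a := by
  have hpos (r : ℝ) : ENNReal.ofReal t < ENNReal.ofReal r ↔ t < r :=
    ENNReal.ofReal_lt_ofReal_iff_of_nonneg ht.le
  by_cases ha : a = ⊤
  · subst ha
    simp only [extendPhi, if_true, ENNReal.ofReal_lt_top, iff_true]
    refine lt_iSup_iff.2 ⟨⟨b + 1, by positivity⟩, ?_⟩
    rw [hpos, h _ (by positivity)]
    linarith
  · rw [extendPhi, if_neg ha, hpos, h _ ENNReal.toReal_nonneg,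
      ← ENNReal.ofReal_lt_iff_lt_toReal hb ha]

lemma extendPhi_le_ofReal {Φ : ℝ → ℝ} {t : ℝ} (h : ∀ s, 0 ≤ s → Φ s ≤ t) (a : ℝ≥0∞) :
    extendPhi Φ a ≤ ENNReal.ofReal t := by
  unfold extendPhi
  split_ifs
  · exact iSup_le fun s => ENNReal.ofReal_le_ofReal (h s s.2)
  · exact ENNReal.ofReal_le_ofReal (h _ ENNReal.toReal_nonneg)

theorem shibata_comp_monotone
    (N : ℕ) (hN : 1 ≤ N) (u v : EucN N → ℝ)
    (hu : Measurable u) (hv : Measurable v)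
    (hupos : ∀ x, 0 ≤ u x) (hvpos : ∀ x, 0 ≤ v x)
    (hu0 : VanishesAtInfinity u) (hv0 : VanishesAtInfinity v)
    (Φ : ℝ → ℝ)
    (hΦpos : ∀ s : ℝ, 0 ≤ s → 0 ≤ Φ s)
    (hΦmono : MonotoneOn Φ (Set.Ici (0 : ℝ)))
    (hΦlsc : LowerSemicontinuousOn Φ (Set.Ici (0 : ℝ)))
    (hΦcont : ContinuousWithinAt Φ (Set.Ici (0 : ℝ)) 0)
    (hΦ0 : Φ 0 = 0) :
    VanishesAtInfinity (fun x => Φ (u x)) ∧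
    VanishesAtInfinity (fun x => Φ (v x)) ∧
    (∀ x : EucN N,
      shibata (fun y => Φ (u y)) (fun y => Φ (v y)) x = extendPhi Φ (shibata u v x)) := by
  have level (w : EucN N → ℝ) (hw : ∀ x, 0 ≤ w x) {t b : ℝ}
      (h : ∀ s, 0 ≤ s → (t < Φ s ↔ b < s)) :
      {y | t < |Φ (w y)|} = {y | b < |w y|} := by
    ext y
    rw [Set.mem_ofPred_eq, Set.mem_ofPred_eq, abs_of_nonneg (hΦpos _ (hw y)), abs_of_nonneg (hw y),
      h _ (hw y)]
  have level_empty (w : EucN N → ℝ) (hw : ∀ x, 0 ≤ w x) {t : ℝ}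
      (h : ∀ s, 0 ≤ s → Φ s ≤ t) : {y | t < |Φ (w y)|} = ∅ := by
    ext y
    simpa [abs_of_nonneg (hΦpos _ (hw y))] using h _ (hw y)
  have vanish (w : EucN N → ℝ) (hw : ∀ x, 0 ≤ w x) (hw0 : VanishesAtInfinity w) :
      VanishesAtInfinity (fun x => Φ (w x)) := by
    intro t ht
    rcases superlevel_empty_or_Ioi hΦmono hΦlsc hΦcont hΦ0 ht with h | ⟨b, hb, h⟩
    · simp [level_empty w hw h]
    · rw [level w hw h]
      exact hw0 b hb
  refine ⟨vanish u hupos hu0, vanish v hvpos hv0, fun x => eq_of_forall_ofReal_lt_iff ?_⟩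
  intro t ht
  rw [ofReal_lt_shibata_iff ht]
  rcases superlevel_empty_or_Ioi hΦmono hΦlsc hΦcont hΦ0 ht with h | ⟨b, hb, h⟩
  · simp [Astar, level_empty u hupos h, level_empty v hvpos h, extendPhi_le_ofReal h]
  · rw [ofReal_lt_extendPhi_iff ht hb.le h, ofReal_lt_shibata_iff hb, Astar, Astar,
      level u hupos h, level v hvpos h]
end
end

section
/- Let a > 0 and b1, b2, c ≥ 0 be real numbers, and let q1, q2, r be real exponents with 0 < q1 < 2, 0 < q2 < 2, r > 2 and |q1 − q2| ≤ 1. Define θ : (0,∞) → ℝ by θ(t) = (a/2)t² − b1·t^{q1} − b2·t^{q2} − c·t^{r} (real powers). Then the set {t ∈ (0,∞) : θ'(t) = 0} has at most two elements; i.e. the map t ↦ θ(t) admits at most two stationary points on (0,∞). -/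
/-- A set of a linear order without three strictly increasing elements is contained in a pair. -/
theorem Set.exists_subset_pair_of_no_three_lt {α : Type*} [LinearOrder α] [Nonempty α] {S : Set α}
    (h : ∀ x ∈ S, ∀ y ∈ S, ∀ z ∈ S, x < y → y < z → False) : ∃ u v : α, S ⊆ {u, v} := by
  by_cases hS : S.Nontrivial
  · obtain ⟨u, hu, v, hv, huv⟩ := hS.exists_lt
    refine ⟨u, v, fun w hw => ?_⟩
    rcases lt_trichotomy w u with hwu | rfl | huw
    · exact (h w hw u hu v hv hwu huv).elim
    · simp
    · rcases lt_trichotomy w v with hwv | rfl | hvw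
      · exact (h u hu w hw v hv huw hwv).elim
      · simp
      · exact (h u hu v hv w hw huv hvw).elim
  · rw [Set.not_nontrivial_iff] at hS
    rcases hS.eq_empty_or_singleton with rfl | ⟨x, rfl⟩
    · obtain ⟨x⟩ := ‹Nonempty α›
      exact ⟨x, x, Set.empty_subset _⟩
    · exact ⟨x, x, by simp⟩

/-- The function `x ↦ exp (x * k)` with `k ≠ 0` is strictly convex. -/
theorem Real.exp_mul_lt_of_ne_zero {k x z l m : ℝ} (hk : k ≠ 0) (hxz : x ≠ z) (hl : 0 < l)
    (hm : 0 < m) (hlm : l + m = 1) :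
    Real.exp ((l * x + m * z) * k) < l * Real.exp (x * k) + m * Real.exp (z * k) := by
  have h := strictConvexOn_exp.2 (Set.mem_univ (x * k)) (Set.mem_univ (z * k))
    (fun h => hxz (mul_right_cancel₀ hk h)) hl hm hlm
  simp only [smul_eq_mul] at h
  rwa [show (l * x + m * z) * k = l * (x * k) + m * (z * k) by ring]

/-- A nonnegative combination of exponentials `exp (x * k)`, `k ≠ 0`, takes a given positive value
at no three distinct points. -/
theorem Real.exp_combination_no_three_lt {A B C a k₁ k₂ k₃ x y z : ℝ} (ha : 0 < a) (hA : 0 ≤ A)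
    (hB : 0 ≤ B) (hC : 0 ≤ C) (hk₁ : k₁ ≠ 0) (hk₂ : k₂ ≠ 0) (hk₃ : k₃ ≠ 0)
    (hxy : x < y) (hyz : y < z)
    (hx : A * Real.exp (x * k₁) + B * Real.exp (x * k₂) + C * Real.exp (x * k₃) = a)
    (hy : A * Real.exp (y * k₁) + B * Real.exp (y * k₂) + C * Real.exp (y * k₃) = a)
    (hz : A * Real.exp (z * k₁) + B * Real.exp (z * k₂) + C * Real.exp (z * k₃) = a) :
    False := by
  have hy_mem : y ∈ openSegment ℝ x z := by
    rw [openSegment_eq_Ioo (hxy.trans hyz)]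
    exact ⟨hxy, hyz⟩
  obtain ⟨l, m, hl, hm, hlm, rfl⟩ := hy_mem
  simp only [smul_eq_mul] at hy
  have hxz := (hxy.trans hyz).ne
  have h₁ := Real.exp_mul_lt_of_ne_zero hk₁ hxz hl hm hlm
  have h₂ := Real.exp_mul_lt_of_ne_zero hk₂ hxz hl hm hlm
  have h₃ := Real.exp_mul_lt_of_ne_zero hk₃ hxz hl hm hlm
  have hle₁ := mul_le_mul_of_nonneg_left h₁.le hA
  have hle₂ := mul_le_mul_of_nonneg_left h₂.le hB
  have hle₃ := mul_le_mul_of_nonneg_left h₃.le hC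
  have hsum : l * a + m * a = a := by rw [← add_mul, hlm, one_mul]
  have hlx := congrArg (l * ·) hx
  have hmz := congrArg (m * ·) hz
  have hA0 : A = 0 := by
    by_contra hne
    have := mul_lt_mul_of_pos_left h₁ (hA.lt_of_ne' hne)
    linarith
  have hB0 : B = 0 := by
    by_contra hne
    have := mul_lt_mul_of_pos_left h₂ (hB.lt_of_ne' hne)
    linarith
  have hC0 : C = 0 := by
    by_contra hne
    have := mul_lt_mul_of_pos_left h₃ (hC.lt_of_ne' hne)
    linarith
  simp only [hA0, hB0, hC0, zero_mul, add_zero] at hx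
  exact ha.ne hx

/-- A positive stationary point of the fibering map satisfies an exponential equation in its
logarithm. -/
theorem exp_equation_of_deriv_fibering_eq_zero {a b1 b2 c q1 q2 r t : ℝ} (ht : 0 < t)
    (h : deriv (fun s : ℝ => a / 2 * s ^ (2 : ℝ) - b1 * s ^ q1 - b2 * s ^ q2 - c * s ^ r) t = 0) :
    b1 * q1 * Real.exp (Real.log t * (q1 - 2)) + b2 * q2 * Real.exp (Real.log t * (q2 - 2))
      + c * r * Real.exp (Real.log t * (r - 2)) = a := by
  have hpow (p : ℝ) : HasDerivAt (fun s : ℝ => s ^ p) (p * t ^ (p - 1)) t :=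
    Real.hasDerivAt_rpow_const (Or.inl ht.ne')
  have hd := ((((hpow 2).const_mul (a / 2)).sub ((hpow q1).const_mul b1)).sub
    ((hpow q2).const_mul b2)).sub ((hpow r).const_mul c)
  replace h := hd.deriv.symm.trans h
  have hsplit (p : ℝ) : t ^ (p - 1) = t * Real.exp (Real.log t * (p - 2)) := by
    rw [← Real.rpow_def_of_pos ht, show p - 1 = 1 + (p - 2) by ring, Real.rpow_add ht,
      Real.rpow_one]
  simp only [hsplit, sub_self, mul_zero, Real.exp_zero] at h
  apply mul_left_cancel₀ ht.ne'
  linear_combination -h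

/-- Second case of the appendix Lemma of the paper (Lemma 4.4/5.1): under `|q1 − q2| ≤ 1`,
the fibering map `θ(t) = (a/2)t² − b1·t^{q1} − b2·t^{q2} − c·t^{r}` admits at most two
stationary points on `(0,∞)`. -/
theorem fibering_at_most_two_critical_points_case2
    (a b1 b2 c : ℝ) (ha : 0 < a) (hb1 : 0 ≤ b1) (hb2 : 0 ≤ b2) (hc : 0 ≤ c)
    (q1 q2 r : ℝ) (hq1 : 0 < q1) (hq1' : q1 < 2) (hq2 : 0 < q2) (hq2' : q2 < 2)
    (hr : 2 < r) (hdiff : |q1 - q2| ≤ 1) :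
    ∃ t1 t2 : ℝ,
      {t : ℝ | 0 < t ∧
        deriv (fun s : ℝ => a / 2 * s ^ (2 : ℝ) - b1 * s ^ q1 - b2 * s ^ q2 - c * s ^ r) t
          = 0} ⊆ {t1, t2} := by
  apply Set.exists_subset_pair_of_no_three_lt
  rintro x ⟨hx, hx'⟩ y ⟨hy, hy'⟩ z ⟨hz, hz'⟩ hxy hyz
  exact Real.exp_combination_no_three_lt ha (mul_nonneg hb1 hq1.le) (mul_nonneg hb2 hq2.le)
    (mul_nonneg hc (by linarith)) (sub_ne_zero.2 hq1'.ne) (sub_ne_zero.2 hq2'.ne)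
    (sub_ne_zero.2 hr.ne') (Real.log_lt_log hx hxy) (Real.log_lt_log hy hyz)
    (exp_equation_of_deriv_fibering_eq_zero hx hx')
    (exp_equation_of_deriv_fibering_eq_zero hy hy')
    (exp_equation_of_deriv_fibering_eq_zero hz hz')
end
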